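/- There exists a consecutive transition instance (with overlap-free labelings L₁ and L₂) and an order of the movements in which some moving label with a diagonal movement overlaps 14 other labels during the transition; hence the bound of 14 overlapping labels per diagonally moving label is tight. -/

import Mathlib

open Set

/-- The closed axis-aligned unit square with lower-left corner `a`. -/
def unitSq (a : ℝ × ℝ) : Set (ℝ × ℝ) :=
  Set.Icc a.1 (a.1 + 1) ×ˢ Set.Icc a.2 (a.2 + 1)

/-- Two unit squares, given by their lower-left corners, overlap if their interiors intersect. -/
def Overlap (a b : ℝ × ℝ) : Prop :=
  (interior (unitSq a) ∩ interior (unitSq b)).Nonempty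

/-- `a` is the lower-left corner of one of the four candidate positions of point `p`
(the four closed unit squares having `p` as a corner). -/
def IsCandidate (p a : ℝ × ℝ) : Prop :=
  a = p ∨ a = (p.1 - 1, p.2) ∨ a = (p.1, p.2 - 1) ∨ a = (p.1 - 1, p.2 - 1)

/-- Two unit squares (given by lower-left corners) share an edge. -/
def SharesEdge (a b : ℝ × ℝ) : Prop :=
  (a.1 = b.1 ∧ (a.2 - b.2 = 1 ∨ b.2 - a.2 = 1)) ∨
  (a.2 = b.2 ∧ (a.1 - b.1 = 1 ∨ b.1 - a.1 = 1))

/-- A movement of the unit-square label of point `p` from candidate position `S` to candidate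
position `E`.  If `S` and `E` share an edge (a non-diagonal movement) we set `I = E` and the
label translates directly from `S` to `E`; if `S` and `E` are diagonally opposite (a diagonal
movement) the label translates through the specified intermediate candidate position `I`,
which shares an edge with both `S` and `E`. -/
structure Movement where
  p : ℝ × ℝ
  S : ℝ × ℝ
  I : ℝ × ℝ
  E : ℝ × ℝ
  candS : IsCandidate p S
  candI : IsCandidate p I
  candE : IsCandidate p E
  legs : (I = E ∧ SharesEdge S E) ∨
    (SharesEdge S I ∧ SharesEdge I E ∧ S.1 ≠ E.1 ∧ S.2 ≠ E.2)

/-- A movement is diagonal if the start and end positions are diagonally opposite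
(equivalently, the intermediate position differs from the end position). -/
def Movement.Diagonal (m : Movement) : Prop := m.I ≠ m.E

/-- Position (lower-left corner) of a moving label at time `t` after the start of its movement:
unit-speed axis-aligned translation, one unit of time per axis-aligned leg; the label rests at
its start position before the movement begins and at its end position after it is finished. -/
noncomputable def Movement.pos (m : Movement) (t : ℝ) : ℝ × ℝ :=
  if t ≤ 0 then m.S
  else if t ≤ 1 then m.S + t • (m.I - m.S)
  else if t ≤ 2 then m.I + (t - 1) • (m.E - m.I)
  else m.E

/-- Duration of a movement: one unit of time per axis-aligned translation. -/
noncomputable def Movement.dur (m : Movement) : ℝ := if m.I = m.E then 1 else 2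

/-- A transition instance: finitely many stationary labels (given by their lower-left corners)
and `n` moving labels, each with a prescribed movement, such that the labeling `L₁` formed by
the stationary labels together with the start positions of the moving labels is overlap-free,
and the labeling `L₂` formed by the stationary labels together with the end positions of the
moving labels is overlap-free. -/
structure TransitionInstance (k n : ℕ) where
  stat : Fin k → ℝ × ℝ
  mov : Fin n → Movement
  free_start : ∀ a b : Fin k ⊕ Fin n, a ≠ b →
    ¬ Overlap (Sum.elim stat (fun j => (mov j).S) a)
      (Sum.elim stat (fun j => (mov j).S) b)
  free_end : ∀ a b : Fin k ⊕ Fin n, a ≠ b →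
    ¬ Overlap (Sum.elim stat (fun j => (mov j).E) a)
      (Sum.elim stat (fun j => (mov j).E) b)

/-- A schedule `τ` of starting times is consecutive if the execution intervals of the movements
are pairwise non-overlapping, i.e. the movements are executed one after another in some order. -/
def Consecutive {k n : ℕ} (T : TransitionInstance k n) (τ : Fin n → ℝ) : Prop :=
  ∀ i j : Fin n, i ≠ j →
    τ i + (T.mov i).dur ≤ τ j ∨ τ j + (T.mov j).dur ≤ τ i

/-- Position (lower-left corner) of each label at global time `t`, when moving label `j`
starts its movement at time `τ j`; stationary labels never move. -/
noncomputable def traj {k n : ℕ} (T : TransitionInstance k n) (τ : Fin n → ℝ) (t : ℝ) :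
    Fin k ⊕ Fin n → ℝ × ℝ :=
  Sum.elim T.stat (fun j => (T.mov j).pos (t - τ j))

/-- The number of overlaps during the transition: the number of unordered pairs of distinct
labels whose interiors intersect at some moment. -/
noncomputable def overlapCount {k n : ℕ} (T : TransitionInstance k n) (τ : Fin n → ℝ) : ℕ :=
  Set.ncard {q : Sym2 (Fin k ⊕ Fin n) | ∃ a b : Fin k ⊕ Fin n,
    q = s(a, b) ∧ a ≠ b ∧ ∃ t : ℝ, Overlap (traj T τ t a) (traj T τ t b)}

/-! Construction: seven labels move before label `7`, seven after it; coordinates are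
doubled so that they are integers. -/

def dS : Fin 15 → ℤ × ℤ :=
  ![(3, -3), (5, 1), (-1, 3), (-1, -3), (-2, 1), (-3, -1), (1, -3), (0, 0), (3, 1), (3, -1), (1, 5), (3, 5), (1, 2), (5, 3), (3, 3)]

def dI : Fin 15 → ℤ × ℤ :=
  ![(1, -3), (3, 1), (-1, 1), (-1, -1), (0, 1), (-1, -1), (-1, -3), (2, 0), (5, 1), (1, -1), (1, 3), (3, 3), (1, 4), (3, 3), (5, 3)]

def dE : Fin 15 → ℤ × ℤ :=
  ![(1, -1), (3, -1), (-3, 1), (-3, -1), (0, 1), (-1, -3), (-1, -1), (2, 2), (5, -1), (1, -3), (-1, 3), (5, 3), (1, 4), (3, 5), (5, 1)]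

def dP : Fin 15 → ℤ × ℤ :=
  ![(3, -1), (5, 1), (-1, 3), (-1, -1), (0, 1), (-1, -1), (1, -1), (2, 2), (5, 1), (3, -1), (1, 5), (5, 5), (1, 4), (5, 5), (5, 3)]

/-- A time at which label `i` overlaps label `7`. -/
def dW : Fin 15 → ℤ :=
  ![2, 15, 5, 7, 9, 11, 14, 0, 15, 15, 21, 23, 16, 27, 16]

/-- Halve integer coordinates. -/
noncomputable def hv (z : ℤ × ℤ) : ℝ × ℝ := ((z.1 : ℝ) / 2, (z.2 : ℝ) / 2)

theorem overlap_iff (a b : ℝ × ℝ) :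
    Overlap a b ↔ (a.1 < b.1 + 1 ∧ b.1 < a.1 + 1) ∧ (a.2 < b.2 + 1 ∧ b.2 < a.2 + 1) := by
  unfold Overlap unitSq
  rw [interior_prod_eq, interior_prod_eq, interior_Icc, interior_Icc, interior_Icc, interior_Icc,
    Set.prod_inter_prod, Set.prod_nonempty_iff, Set.Ioo_inter_Ioo, Set.Ioo_inter_Ioo,
    Set.nonempty_Ioo, Set.nonempty_Ioo]
  simp only [sup_lt_iff, lt_inf_iff]
  constructor
  · rintro ⟨⟨⟨_, h1⟩, h2, _⟩, ⟨_, h3⟩, h4, _⟩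
    exact ⟨⟨h2, h1⟩, h4, h3⟩
  · rintro ⟨⟨h1, h2⟩, h3, h4⟩
    refine ⟨⟨⟨?_, h2⟩, h1, ?_⟩, ⟨?_, h4⟩, h3, ?_⟩ <;> linarith

/-- Overlap in doubled integer coordinates. -/
def ovZ (z w : ℤ × ℤ) : Prop :=
  (z.1 < w.1 + 2 ∧ w.1 < z.1 + 2) ∧ (z.2 < w.2 + 2 ∧ w.2 < z.2 + 2)

instance (z w : ℤ × ℤ) : Decidable (ovZ z w) := by unfold ovZ; infer_instance

theorem lt_half (x y : ℤ) : (x : ℝ) / 2 < (y : ℝ) / 2 + 1 ↔ x < y + 2 := by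
  rw [← @Int.cast_lt ℝ]
  push_cast
  constructor <;> intro h <;> linarith

theorem overlap_hv (z w : ℤ × ℤ) : Overlap (hv z) (hv w) ↔ ovZ z w := by
  rw [overlap_iff]
  simp only [hv, ovZ, lt_half]

def candZ (p a : ℤ × ℤ) : Prop :=
  a = p ∨ a = (p.1 - 2, p.2) ∨ a = (p.1, p.2 - 2) ∨ a = (p.1 - 2, p.2 - 2)

instance (z w : ℤ × ℤ) : Decidable (candZ z w) := by unfold candZ; infer_instance

theorem cand_hv {p a : ℤ × ℤ} (h : candZ p a) : IsCandidate (hv p) (hv a) := by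
  unfold IsCandidate
  rcases h with h | h | h | h <;> subst h
  · exact Or.inl rfl
  · refine Or.inr (Or.inl ?_)
    ext <;> simp [hv] <;> ring
  · refine Or.inr (Or.inr (Or.inl ?_))
    ext <;> simp [hv] <;> ring
  · refine Or.inr (Or.inr (Or.inr ?_))
    ext <;> simp [hv] <;> ring

def edgeZ (a b : ℤ × ℤ) : Prop :=
  (a.1 = b.1 ∧ (a.2 = b.2 + 2 ∨ b.2 = a.2 + 2)) ∨
  (a.2 = b.2 ∧ (a.1 = b.1 + 2 ∨ b.1 = a.1 + 2))

instance (z w : ℤ × ℤ) : Decidable (edgeZ z w) := by unfold edgeZ; infer_instance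

theorem edge_hv {a b : ℤ × ℤ} (h : edgeZ a b) : SharesEdge (hv a) (hv b) := by
  unfold SharesEdge
  simp only [hv]
  rcases h with ⟨h, h' | h'⟩ | ⟨h, h' | h'⟩
  · exact Or.inl ⟨by rw [h], Or.inl (by rw [h']; push_cast; ring)⟩
  · exact Or.inl ⟨by rw [h], Or.inr (by rw [h']; push_cast; ring)⟩
  · exact Or.inr ⟨by rw [h], Or.inl (by rw [h']; push_cast; ring)⟩
  · exact Or.inr ⟨by rw [h], Or.inr (by rw [h']; push_cast; ring)⟩

theorem half_ne {x y : ℤ} (h : x ≠ y) : (x : ℝ) / 2 ≠ (y : ℝ) / 2 := by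
  intro h'
  apply h
  have : (x : ℝ) = y := by linarith
  exact_mod_cast this

theorem data_cand : ∀ i, candZ (dP i) (dS i) ∧ candZ (dP i) (dI i) ∧ candZ (dP i) (dE i) := by
  decide

theorem data_legs : ∀ i, (dI i = dE i ∧ edgeZ (dS i) (dE i)) ∨
    (edgeZ (dS i) (dI i) ∧ edgeZ (dI i) (dE i) ∧ (dS i).1 ≠ (dE i).1 ∧ (dS i).2 ≠ (dE i).2) := by
  decide

theorem data_start : ∀ i j, i ≠ j → ¬ ovZ (dS i) (dS j) := by decide

theorem data_end : ∀ i j, i ≠ j → ¬ ovZ (dE i) (dE j) := by decide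

noncomputable def mv (i : Fin 15) : Movement where
  p := hv (dP i)
  S := hv (dS i)
  I := hv (dI i)
  E := hv (dE i)
  candS := cand_hv (data_cand i).1
  candI := cand_hv (data_cand i).2.1
  candE := cand_hv (data_cand i).2.2
  legs := by
    rcases data_legs i with ⟨h, h'⟩ | ⟨h1, h2, h3, h4⟩
    · exact Or.inl ⟨by rw [h], edge_hv h'⟩
    · exact Or.inr ⟨edge_hv h1, edge_hv h2, half_ne h3, half_ne h4⟩

noncomputable def inst : TransitionInstance 0 15 where
  stat := Fin.elim0
  mov := mv
  free_start := by
    rintro (a | a) (b | b) hab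
    · exact a.elim0
    · exact a.elim0
    · exact b.elim0
    · exact fun h => data_start a b (fun e => hab (by rw [e])) ((overlap_hv _ _).1 h)
  free_end := by
    rintro (a | a) (b | b) hab
    · exact a.elim0
    · exact a.elim0
    · exact b.elim0
    · exact fun h => data_end a b (fun e => hab (by rw [e])) ((overlap_hv _ _).1 h)

/-- Doubled position at integer time `u` after the start of the movement. -/
def posZ (i : Fin 15) (u : ℤ) : ℤ × ℤ :=
  if u ≤ 0 then dS i else if u = 1 then dI i else dE i

theorem pos_int (i : Fin 15) (u : ℤ) : (mv i).pos (u : ℝ) = hv (posZ i u) := by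
  unfold posZ Movement.pos
  by_cases h0 : u ≤ 0
  · have h0' : (u : ℝ) ≤ 0 := by exact_mod_cast h0
    rw [if_pos h0, if_pos h0']; rfl
  have h0' : ¬ (u : ℝ) ≤ 0 := by exact_mod_cast h0
  rw [if_neg h0, if_neg h0']
  by_cases h1 : u = 1
  · subst h1
    simp [mv]
  have h1' : ¬ (u : ℝ) ≤ 1 := by
    intro h
    have : u ≤ 1 := by exact_mod_cast h
    omega
  rw [if_neg h1, if_neg h1']
  by_cases h2 : u = 2
  · subst h2
    norm_num [mv]
  have h2' : ¬ (u : ℝ) ≤ 2 := by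
    intro h
    have : u ≤ 2 := by exact_mod_cast h
    omega
  rw [if_neg h2']; rfl

noncomputable def sched (i : Fin 15) : ℝ := ((2 * (i.val : ℤ) : ℤ) : ℝ)

theorem dur_le (m : Movement) : m.dur ≤ 2 := by
  unfold Movement.dur
  split_ifs <;> norm_num

theorem sched_step {i j : Fin 15} (h : i < j) : sched i + (mv i).dur ≤ sched j := by
  have h1 : (i.val : ℝ) + 1 ≤ j.val := by exact_mod_cast h
  have h2 := dur_le (mv i)
  unfold sched
  push_cast
  linarith

theorem data_overlap : ∀ i : Fin 15, i ≠ 7 →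
    ovZ (posZ i (dW i - 2 * (i.val : ℤ))) (posZ 7 (dW i - 2 * ((7 : Fin 15).val : ℤ))) := by
  decide

theorem traj_int (u : ℤ) (i : Fin 15) :
    traj inst sched (u : ℝ) (Sum.inr i) = hv (posZ i (u - 2 * (i.val : ℤ))) := by
  rw [← pos_int]
  simp [traj, inst, sched]

/-- There exists a consecutive transition instance and an order of the movements in which some
moving label with a diagonal movement overlaps `14` other labels during the transition; hence
the bound of `14` overlapping labels per diagonally moving label is tight. -/
theorem consecutive_diagonal_degree_tight :
    ∃ (k n : ℕ) (T : TransitionInstance k n) (τ : Fin n → ℝ) (j : Fin n),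
      Consecutive T τ ∧ (T.mov j).Diagonal ∧
      {a : Fin k ⊕ Fin n | a ≠ Sum.inr j ∧
        ∃ t : ℝ, Overlap (traj T τ t a) (traj T τ t (Sum.inr j))}.ncard = 14 := by
  refine ⟨0, 15, inst, sched, 7, ?_, ?_, ?_⟩
  · intro i j hij
    rcases lt_or_gt_of_ne hij with h | h
    · exact Or.inl (sched_step h)
    · exact Or.inr (sched_step h)
  · intro h
    have h1 : (hv (dI 7)).2 = (hv (dE 7)).2 := congrArg Prod.snd h
    exact half_ne (by decide : (dI 7).2 ≠ (dE 7).2) h1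
  · have key : {a : Fin 0 ⊕ Fin 15 | a ≠ Sum.inr 7 ∧
        ∃ t : ℝ, Overlap (traj inst sched t a) (traj inst sched t (Sum.inr 7))}
        = ({Sum.inr 7}ᶜ : Set (Fin 0 ⊕ Fin 15)) := by
      ext a
      constructor
      · rintro ⟨h, _⟩
        exact h
      · intro h
        refine ⟨h, ?_⟩
        rcases a with a | a
        · exact a.elim0
        · refine ⟨((dW a : ℤ) : ℝ), ?_⟩
          rw [traj_int, traj_int, overlap_hv]
          exact data_overlap a (fun e => h (by rw [e]; rfl))
    rw [key, Set.ncard_compl, Set.ncard_singleton]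
    simp
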